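/- arXiv:math/0312256 — 2 statements merged into one kernel-verified Lean document; each statement's English description precedes it below -/
import Mathlib

section
/- Let R := [x₁,x₂] × [y₁,y₂] with x₁ < x₂, y₁ < y₂, let A, B be continuously differentiable and C continuous on R, and let U be twice continuously differentiable on R satisfying U_{wz} − (AU)_w − (BU)_z + CU = 0 on R. Define f(w) := U(w,y₂), g(z) := U(x₁,z), f̃(w) := f(w) − ∫_{x₁}^{w} B(s,y₂) f(s) ds and g̃(z) := g(z) − ∫_{y₂}^{z} A(x₁,t) g(t) dt (oriented integrals). Then for every (w,z) ∈ R: U(w,z) = f̃(w) + g̃(z) − U(x₁,y₂) + ∫_{y₂}^{z} A(w,t) U(w,t) dt + ∫_{x₁}^{w} B(s,z) U(s,z) ds − ∫_{x₁}^{w} ∫_{y₂}^{z} C(s,t) U(s,t) dt ds. -/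
open Set intervalIntegral

/-- The partial derivative of a continuously differentiable function in its first variable. -/
theorem hasDerivAt_fst_of_contDiff {H : ℝ → ℝ → ℝ} (hH : ContDiff ℝ 1 (fun p : ℝ × ℝ => H p.1 p.2))
    (w z : ℝ) :
    HasDerivAt (fun w' => H w' z) (fderiv ℝ (fun p : ℝ × ℝ => H p.1 p.2) (w, z) (1, 0)) w :=
  HasFDerivAt.comp_hasDerivAt (f := fun w' => (w', z)) w
    (hH.differentiable one_ne_zero (w, z)).hasFDerivAt
    ((hasDerivAt_id' w).prodMk (hasDerivAt_const w z))

/-- The partial derivative of a continuously differentiable function in its second variable. -/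
theorem hasDerivAt_snd_of_contDiff {H : ℝ → ℝ → ℝ} (hH : ContDiff ℝ 1 (fun p : ℝ × ℝ => H p.1 p.2))
    (w z : ℝ) :
    HasDerivAt (fun z' => H w z') (fderiv ℝ (fun p : ℝ × ℝ => H p.1 p.2) (w, z) (0, 1)) z :=
  HasFDerivAt.comp_hasDerivAt (f := fun z' => (w, z')) z
    (hH.differentiable one_ne_zero (w, z)).hasFDerivAt
    ((hasDerivAt_const z w).prodMk (hasDerivAt_id' z))

theorem continuous_deriv_fst {H : ℝ → ℝ → ℝ} (hH : ContDiff ℝ 1 (fun p : ℝ × ℝ => H p.1 p.2)) :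
    Continuous (fun p : ℝ × ℝ => deriv (fun w' => H w' p.2) p.1) := by
  simp_rw [fun p : ℝ × ℝ => (hasDerivAt_fst_of_contDiff hH p.1 p.2).deriv]
  exact (hH.continuous_fderiv one_ne_zero).clm_apply continuous_const

theorem continuous_deriv_snd {H : ℝ → ℝ → ℝ} (hH : ContDiff ℝ 1 (fun p : ℝ × ℝ => H p.1 p.2)) :
    Continuous (fun p : ℝ × ℝ => deriv (fun z' => H p.1 z') p.2) := by
  simp_rw [fun p : ℝ × ℝ => (hasDerivAt_snd_of_contDiff hH p.1 p.2).deriv]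
  exact (hH.continuous_fderiv one_ne_zero).clm_apply continuous_const

theorem contDiff_deriv_fst {H : ℝ → ℝ → ℝ} (hH : ContDiff ℝ 2 (fun p : ℝ × ℝ => H p.1 p.2)) :
    ContDiff ℝ 1 (fun p : ℝ × ℝ => deriv (fun w' => H w' p.2) p.1) := by
  simp_rw [fun p : ℝ × ℝ =>
    (hasDerivAt_fst_of_contDiff (hH.of_le one_le_two) p.1 p.2).deriv]
  exact (hH.fderiv_right (m := 1) (by norm_num)).clm_apply contDiff_const

theorem integral_deriv_fst {H : ℝ → ℝ → ℝ} (hH : ContDiff ℝ 1 (fun p : ℝ × ℝ => H p.1 p.2))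
    (a b z : ℝ) : ∫ s in a..b, deriv (fun w' => H w' z) s = H b z - H a z :=
  integral_deriv_eq_sub (f := fun w' => H w' z)
    (fun w _ => (hasDerivAt_fst_of_contDiff hH w z).differentiableAt)
    (((continuous_deriv_fst hH).comp (Continuous.prodMk_left z)).intervalIntegrable a b)

theorem integral_deriv_snd {H : ℝ → ℝ → ℝ} (hH : ContDiff ℝ 1 (fun p : ℝ × ℝ => H p.1 p.2))
    (a b w : ℝ) : ∫ t in a..b, deriv (fun z' => H w z') t = H w b - H w a :=
  integral_deriv_eq_sub (f := fun z' => H w z')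
    (fun z _ => (hasDerivAt_snd_of_contDiff hH w z).differentiableAt)
    (((continuous_deriv_snd hH).comp (Continuous.prodMk_right w)).intervalIntegrable a b)

theorem intervalIntegral_swap_of_continuous {F : ℝ → ℝ → ℝ}
    (hF : Continuous (fun p : ℝ × ℝ => F p.1 p.2)) (a b c d : ℝ) :
    ∫ s in a..b, ∫ t in c..d, F s t = ∫ t in c..d, ∫ s in a..b, F s t := by
  refine MeasureTheory.intervalIntegral_intervalIntegral_swap ?_
  exact (hF.continuousOn.integrableOn_compact (isCompact_uIcc.prod isCompact_uIcc)).mono_set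
    (prod_mono uIoc_subset_uIcc uIoc_subset_uIcc)

/-- Integral-equation representation of a solution of
U_{wz} − (AU)_w − (BU)_z + CU = 0 on a rectangle, in terms of its data on the
two sides w = x₁ and z = y₂ (all integrals oriented). -/
theorem stmt_12 (x₁ x₂ y₁ y₂ : ℝ) (hx : x₁ < x₂) (hy : y₁ < y₂)
    (A B C U : ℝ → ℝ → ℝ)
    (hA : ContDiff ℝ 1 (fun p : ℝ × ℝ => A p.1 p.2))
    (hB : ContDiff ℝ 1 (fun p : ℝ × ℝ => B p.1 p.2))
    (hC : Continuous (fun p : ℝ × ℝ => C p.1 p.2))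
    (hU : ContDiff ℝ 2 (fun p : ℝ × ℝ => U p.1 p.2))
    (hPDE : ∀ w ∈ Icc x₁ x₂, ∀ z ∈ Icc y₁ y₂,
      deriv (fun z' => deriv (fun w' => U w' z') w) z
        - deriv (fun w' => A w' z * U w' z) w
        - deriv (fun z' => B w z' * U w z') z
        + C w z * U w z = 0) :
    ∀ w ∈ Icc x₁ x₂, ∀ z ∈ Icc y₁ y₂,
      U w z = (U w y₂ - ∫ s in x₁..w, B s y₂ * U s y₂)
            + (U x₁ z - ∫ t in y₂..z, A x₁ t * U x₁ t)
            - U x₁ y₂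
            + (∫ t in y₂..z, A w t * U w t)
            + (∫ s in x₁..w, B s z * U s z)
            - ∫ s in x₁..w, ∫ t in y₂..z, C s t * U s t := by
  intro w hw z hz
  have hF : ContDiff ℝ 1 (fun p : ℝ × ℝ => A p.1 p.2 * U p.1 p.2) :=
    hA.mul (hU.of_le one_le_two)
  have hG : ContDiff ℝ 1 (fun p : ℝ × ℝ => B p.1 p.2 * U p.1 p.2) :=
    hB.mul (hU.of_le one_le_two)
  have hD : Continuous (fun p : ℝ × ℝ => C p.1 p.2 * U p.1 p.2) := hC.mul hU.continuous
  have hV := contDiff_deriv_fst hU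
  have cV := continuous_deriv_snd (H := fun w z => deriv (fun w' => U w' z) w) hV
  have cF := continuous_deriv_fst (H := fun w z => A w z * U w z) hF
  have cG := continuous_deriv_snd (H := fun w z => B w z * U w z) hG
  have slice_fst {f : ℝ × ℝ → ℝ} (hf : Continuous f) (t a b : ℝ) :
      IntervalIntegrable (fun s => f (s, t)) MeasureTheory.volume a b :=
    (hf.comp (Continuous.prodMk_left t)).intervalIntegrable a b
  have slice_snd {f : ℝ × ℝ → ℝ} (hf : Continuous f) (s a b : ℝ) :
      IntervalIntegrable (fun t => f (s, t)) MeasureTheory.volume a b :=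
    (hf.comp (Continuous.prodMk_right s)).intervalIntegrable a b
  have param {f : ℝ × ℝ → ℝ} (hf : Continuous f) :
      IntervalIntegrable (fun s => ∫ t in y₂..z, f (s, t)) MeasureTheory.volume x₁ w :=
    (continuous_parametric_intervalIntegral_of_continuous' (f := fun s t => f (s, t))
      hf y₂ z).intervalIntegrable x₁ w
  have hwsub : uIcc x₁ w ⊆ Icc x₁ x₂ := uIcc_subset_Icc (left_mem_Icc.2 hx.le) hw
  have hzsub : uIcc y₂ z ⊆ Icc y₁ y₂ := uIcc_subset_Icc (right_mem_Icc.2 hy.le) hz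
  have hVint : ∫ s in x₁..w, ∫ t in y₂..z, deriv (fun z' => deriv (fun w' => U w' z') s) t
      = (U w z - U x₁ z) - (U w y₂ - U x₁ y₂) := by
    simp_rw [integral_deriv_snd (H := fun w z => deriv (fun w' => U w' z) w) hV]
    rw [integral_sub (slice_fst hV.continuous z _ _) (slice_fst hV.continuous y₂ _ _),
      integral_deriv_fst (hU.of_le one_le_two), integral_deriv_fst (hU.of_le one_le_two)]
  have hFint : ∫ s in x₁..w, ∫ t in y₂..z, deriv (fun w' => A w' t * U w' t) s
      = (∫ t in y₂..z, A w t * U w t) - ∫ t in y₂..z, A x₁ t * U x₁ t := by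
    rw [intervalIntegral_swap_of_continuous cF]
    simp_rw [integral_deriv_fst (H := fun w z => A w z * U w z) hF]
    exact integral_sub (slice_snd hF.continuous w _ _) (slice_snd hF.continuous x₁ _ _)
  have hGint : ∫ s in x₁..w, ∫ t in y₂..z, deriv (fun z' => B s z' * U s z') t
      = (∫ s in x₁..w, B s z * U s z) - ∫ s in x₁..w, B s y₂ * U s y₂ := by
    simp_rw [integral_deriv_snd (H := fun w z => B w z * U w z) hG]
    exact integral_sub (slice_fst hG.continuous z _ _) (slice_fst hG.continuous y₂ _ _)
  have hsum : ∫ s in x₁..w, ∫ t in y₂..z, deriv (fun z' => deriv (fun w' => U w' z') s) t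
      = (∫ s in x₁..w, ∫ t in y₂..z, deriv (fun w' => A w' t * U w' t) s)
        + (∫ s in x₁..w, ∫ t in y₂..z, deriv (fun z' => B s z' * U s z') t)
        - ∫ s in x₁..w, ∫ t in y₂..z, C s t * U s t := by
    rw [← integral_add (param cF) (param cG),
      ← integral_sub ((param cF).add (param cG)) (param hD)]
    refine integral_congr fun s hs => ?_
    simp only
    rw [← integral_add (slice_snd cF s _ _) (slice_snd cG s _ _),
      ← integral_sub ((slice_snd cF s _ _).add (slice_snd cG s _ _)) (slice_snd hD s _ _)]
    refine integral_congr fun t ht => ?_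
    simp only
    linarith [hPDE s (hwsub hs) t (hzsub ht)]
  linarith
end

section
/- Suppose ∫₀¹ b(s) ds = 0. Then there exists γ₀ > 0, depending only on m, the joint law of (ξ, ζ) and the function b, such that for every l ∈ ℕ and every x ∈ ℝ^d with P(ζ̄_l = x) > 0: log E[ exp{ γ₀ · l · ⟨b,ξ⟩_l² } | ζ̄_l = x ] ≤ 1. -/
open Finset
open scoped Classical

/-- Product weight of a configuration under the i.i.d. law π. -/
noncomputable def wt {Ω : Type} [Fintype Ω] (π : Ω → ℝ) {k : ℕ}
    (σ : Fin k → Ω) : ℝ := ∏ i, π (σ i)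

/-- ξ_j(σ) := ξ(ω_j, …, ω_{j+m−1}) (0-based window starting at j). -/
noncomputable def xiAt {Ω : Type} {m : ℕ} (ξ : (Fin m → Ω) → ℝ) {l : ℕ}
    (σ : Fin (l + m) → Ω) (j : Fin l) : ℝ :=
  ξ (fun i : Fin m => σ ⟨j.1 + i.1, by have := j.isLt; have := i.isLt; omega⟩)

/-- Weighted block average ⟨b,ξ⟩_l = (1/l) Σ_{j=1}^{l} b(j/l) ξ_j. -/
noncomputable def bAvg {Ω : Type} (b : ℝ → ℝ) {m : ℕ} (ξ : (Fin m → Ω) → ℝ)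
    {l : ℕ} (σ : Fin (l + m) → Ω) : ℝ :=
  (l : ℝ)⁻¹ * ∑ j : Fin l, b (((j.1 : ℝ) + 1) / l) * xiAt ξ σ j

/-- Plain block average ζ̄_l = (1/l) Σ_{j=1}^{l} ζ_j (vector valued). -/
noncomputable def zAvg {Ω : Type} {d : ℕ} (ζ : Ω → Fin d → ℝ) {l m : ℕ}
    (σ : Fin (l + m) → Ω) : Fin d → ℝ :=
  fun i => (l : ℝ)⁻¹ * ∑ j : Fin l, ζ (σ ⟨j.1, by have := j.isLt; omega⟩) i

/-- Conditional expectation E[f | ζ̄_l = x] under the i.i.d. law π. -/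
noncomputable def condExp {Ω : Type} [Fintype Ω] (π : Ω → ℝ) {d : ℕ}
    (ζ : Ω → Fin d → ℝ) {l m : ℕ} (x : Fin d → ℝ)
    (f : (Fin (l + m) → Ω) → ℝ) : ℝ :=
  (∑ σ : Fin (l + m) → Ω, if zAvg ζ σ = x then wt π σ * f σ else 0) /
  (∑ σ : Fin (l + m) → Ω, if zAvg ζ σ = x then wt π σ else 0)

open scoped BigOperators

theorem exp_le_add_exp_sq (x : ℝ) : Real.exp x ≤ x + Real.exp (x ^ 2) := by
  have h1 := Real.add_one_le_exp (x ^ 2)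
  rcases le_or_gt |x| 1 with h | h
  · have := (abs_le.mp (Real.abs_exp_sub_one_sub_id_le h)).2
    linarith
  · rcases lt_abs.mp h with h | h
    · have : Real.exp x ≤ Real.exp (x ^ 2) := Real.exp_le_exp.mpr (by nlinarith)
      linarith
    · have : Real.exp x ≤ 1 := Real.exp_le_one_iff.mpr (by linarith)
      nlinarith

/-- A Hoeffding-type bound for the uniform law on a finite type. -/
theorem expect_exp_sub_expect_le {ι : Type*} [Fintype ι] [Nonempty ι] (G : ι → ℝ) (c t : ℝ)
    (hG : ∀ i j, |G i - G j| ≤ c) :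
    𝔼 i, Real.exp (t * (G i - 𝔼 j, G j)) ≤ Real.exp (c ^ 2 * t ^ 2) := by
  set M := 𝔼 j, G j with hM
  have hdev (i : ι) : |G i - M| ≤ c := by
    have : G i - M = 𝔼 j, (G i - G j) := by
      rw [Finset.expect_sub_distrib, Fintype.expect_const]
    rw [this]
    refine (Finset.abs_expect_le _ _).trans ?_
    exact Finset.expect_le univ_nonempty fun j _ => hG i j
  have hmean : 𝔼 i, t * (G i - M) = 0 := by
    rw [← Finset.mul_expect, Finset.expect_sub_distrib, Fintype.expect_const, ← hM, sub_self,
      mul_zero]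
  calc 𝔼 i, Real.exp (t * (G i - M))
      ≤ 𝔼 i, (t * (G i - M) + Real.exp (c ^ 2 * t ^ 2)) := by
        refine Finset.expect_le_expect fun i _ => (exp_le_add_exp_sq _).trans ?_
        gcongr
        rw [mul_pow, mul_comm]
        gcongr ?_ * _
        exact sq_le_sq' (by linarith [(abs_le.mp (hdev i)).1]) (abs_le.mp (hdev i)).2
    _ = Real.exp (c ^ 2 * t ^ 2) := by
        rw [Finset.expect_add_distrib, hmean, Fintype.expect_const, zero_add]

theorem decomposeFin_symm_eq_swap_mul {n : ℕ} (p : Fin (n + 1)) (e : Equiv.Perm (Fin n)) :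
    Equiv.Perm.decomposeFin.symm (p, e)
      = Equiv.swap 0 p * Equiv.Perm.decomposeFin.symm (0, e) := by
  ext x
  refine Fin.cases ?_ (fun x => ?_) x <;> simp

theorem decomposeFin_symm_swap_mul {n : ℕ} (p : Fin (n + 1)) (i j : Fin n)
    (e : Equiv.Perm (Fin n)) :
    Equiv.Perm.decomposeFin.symm (p, Equiv.swap i j * e)
      = Equiv.swap (Equiv.swap 0 p i.succ) (Equiv.swap 0 p j.succ)
        * Equiv.Perm.decomposeFin.symm (p, e) := by
  have hsucc (y : Fin n) :
      (Equiv.swap i j y).succ = Equiv.swap i.succ j.succ y.succ :=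
    ((Fin.succ_injective n).swap_apply i j y).symm
  rw [Equiv.swap_apply_apply]
  refine Equiv.ext fun x => ?_
  refine Fin.cases ?_ (fun x => ?_) x
  · simp [Equiv.swap_apply_of_ne_of_ne (Fin.succ_ne_zero i).symm (Fin.succ_ne_zero j).symm]
  · simp [hsucc]

/-- Concentration for functions of a uniform random permutation that change by at most `c`
under transpositions. -/
theorem expect_perm_exp_le (c t : ℝ) (n : ℕ) (F : Equiv.Perm (Fin n) → ℝ)
    (hF : ∀ i j g, |F (Equiv.swap i j * g) - F g| ≤ c) :
    𝔼 g, Real.exp (t * (F g - 𝔼 h, F h)) ≤ Real.exp (n * ((2 * c) ^ 2 * t ^ 2)) := by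
  induction n with
  | zero =>
    have h (g : Equiv.Perm (Fin 0)) : F g = F 1 := congrArg F (Subsingleton.elim _ _)
    simp [h]
  | succ n ih =>
    set F' : Fin (n + 1) → Equiv.Perm (Fin n) → ℝ :=
      fun p e => F (Equiv.Perm.decomposeFin.symm (p, e)) with hF'
    have key (H : Equiv.Perm (Fin (n + 1)) → ℝ) :
        𝔼 g, H g = 𝔼 p, 𝔼 e, H (Equiv.Perm.decomposeFin.symm (p, e)) := by
      rw [← Finset.expect_product' univ univ
        (fun p e => H (Equiv.Perm.decomposeFin.symm (p, e)))]
      exact Fintype.expect_equiv Equiv.Perm.decomposeFin _ _ fun g => by simp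
    set G : Fin (n + 1) → ℝ := fun p => 𝔼 e, F' p e with hG
    set M := 𝔼 p, G p with hM
    have hFM : 𝔼 h, F h = M := key F
    have hGdiff (p q : Fin (n + 1)) : |G p - G q| ≤ 2 * c := by
      rw [hG]
      simp only [← Finset.expect_sub_distrib]
      refine (Finset.abs_expect_le _ _).trans ?_
      refine Finset.expect_le univ_nonempty fun e _ => ?_
      simp only [hF']
      rw [decomposeFin_symm_eq_swap_mul p, decomposeFin_symm_eq_swap_mul q]
      have h1 := abs_le.mp (hF 0 p (Equiv.Perm.decomposeFin.symm (0, e)))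
      have h2 := abs_le.mp (hF 0 q (Equiv.Perm.decomposeFin.symm (0, e)))
      exact abs_le.mpr ⟨by linarith, by linarith⟩
    have hinner (p : Fin (n + 1)) :
        𝔼 e, Real.exp (t * (F' p e - G p)) ≤ Real.exp (n * ((2 * c) ^ 2 * t ^ 2)) := by
      refine ih (F' p) fun i j e => ?_
      simp only [hF']
      rw [decomposeFin_symm_swap_mul]
      exact hF _ _ _
    rw [hFM, key]
    calc 𝔼 p, 𝔼 e, Real.exp (t * (F' p e - M))
        = 𝔼 p, Real.exp (t * (G p - M)) * 𝔼 e, Real.exp (t * (F' p e - G p)) := by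
          refine Finset.expect_congr rfl fun p _ => ?_
          rw [Finset.mul_expect]
          refine Finset.expect_congr rfl fun e _ => ?_
          rw [← Real.exp_add]
          ring_nf
      _ ≤ 𝔼 p, Real.exp (t * (G p - M)) * Real.exp (n * ((2 * c) ^ 2 * t ^ 2)) :=
          Finset.expect_le_expect fun p _ =>
            mul_le_mul_of_nonneg_left (hinner p) (Real.exp_pos _).le
      _ ≤ Real.exp ((2 * c) ^ 2 * t ^ 2) * Real.exp (n * ((2 * c) ^ 2 * t ^ 2)) := by
          rw [← Finset.expect_mul]
          exact mul_le_mul_of_nonneg_right (expect_exp_sub_expect_le G _ t hGdiff)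
            (Real.exp_pos _).le
      _ = _ := by
          rw [← Real.exp_add]
          push_cast
          ring_nf

theorem integral_exp_neg_sq_add_mul (a : ℝ) :
    ∫ z : ℝ, Real.exp (-z ^ 2 + 2 * a * z) = √Real.pi * Real.exp (a ^ 2) := by
  have h (z : ℝ) : Real.exp (-z ^ 2 + 2 * a * z)
      = Real.exp (-1 * (z - a) ^ 2) * Real.exp (a ^ 2) := by
    rw [← Real.exp_add]; ring_nf
  simp only [h]
  rw [MeasureTheory.integral_mul_const,
    MeasureTheory.integral_sub_right_eq_self (fun z : ℝ => Real.exp (-1 * z ^ 2)) a,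
    integral_gaussian, div_one]

theorem integrable_exp_neg_sq_add_mul (a : ℝ) :
    MeasureTheory.Integrable fun z : ℝ => Real.exp (-z ^ 2 + 2 * a * z) := by
  refine MeasureTheory.Integrable.of_integral_ne_zero ?_
  rw [integral_exp_neg_sq_add_mul]
  positivity

/-- Gaussian averaging: a sub-Gaussian exponential moment bound gives an
exponential moment of the square. -/
theorem expect_exp_sq_le {ι : Type*} [Fintype ι] [Nonempty ι] (X : ι → ℝ) (V s : ℝ)
    (hs : 0 ≤ s) (hX : ∀ t, 𝔼 i, Real.exp (t * X i) ≤ Real.exp (V * t ^ 2))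
    (hVs : 8 * V * s ≤ 1) :
    𝔼 i, Real.exp (s * X i ^ 2) ≤ √2 := by
  have hint (i : ι) := integrable_exp_neg_sq_add_mul (√s * X i)
  have hpi : 0 < √Real.pi := Real.sqrt_pos.mpr Real.pi_pos
  have h1 : √Real.pi * 𝔼 i, Real.exp (s * X i ^ 2)
      = ∫ z : ℝ, 𝔼 i, Real.exp (-z ^ 2 + 2 * (√s * X i) * z) := by
    simp only [Finset.expect_eq_sum_div_card]
    rw [MeasureTheory.integral_div, MeasureTheory.integral_finsetSum _ fun i _ => hint i]
    simp only [integral_exp_neg_sq_add_mul, mul_pow, Real.sq_sqrt hs]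
    rw [← Finset.mul_sum, mul_div_assoc]
  have h2 : ∫ z : ℝ, 𝔼 i, Real.exp (-z ^ 2 + 2 * (√s * X i) * z)
      ≤ ∫ z : ℝ, Real.exp (-(1 / 2) * z ^ 2) := by
    refine MeasureTheory.integral_mono ?_ (integrable_exp_neg_mul_sq (by norm_num)) fun z => ?_
    · simp only [Finset.expect_eq_sum_div_card]
      exact (MeasureTheory.integrable_finsetSum _ fun i _ => hint i).div_const _
    · have : 𝔼 i, Real.exp (-z ^ 2 + 2 * (√s * X i) * z)
          = Real.exp (-z ^ 2) * 𝔼 i, Real.exp ((2 * √s * z) * X i) := by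
        rw [Finset.mul_expect]
        refine Finset.expect_congr rfl fun i _ => ?_
        rw [← Real.exp_add]; ring_nf
      simp only
      rw [this]
      refine (mul_le_mul_of_nonneg_left (hX _) (Real.exp_pos _).le).trans ?_
      rw [← Real.exp_add, Real.exp_le_exp, mul_pow, mul_pow, Real.sq_sqrt hs]
      nlinarith [sq_nonneg z]
  rw [integral_gaussian] at h2
  have h3 : √(Real.pi / (1 / 2)) = √Real.pi * √2 := by
    rw [← Real.sqrt_mul Real.pi_pos.le]; congr 1; ring
  rw [h3, ← h1] at h2
  exact le_of_mul_le_mul_left h2 hpi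

theorem abs_sum_div_le_of_integral_eq_zero (b : ℝ → ℝ) (hc : Continuous b) (L : ℝ)
    (hL : ∀ x ∈ Set.Icc (0 : ℝ) 1, ∀ y ∈ Set.Icc (0 : ℝ) 1, |b x - b y| ≤ L * |x - y|)
    (hb0 : (∫ s in (0 : ℝ)..1, b s) = 0) (l : ℕ) (hl : 0 < l) :
    |∑ j : Fin l, b (((j.1 : ℝ) + 1) / l)| ≤ L := by
  have hl' : (0 : ℝ) < l := by exact_mod_cast hl
  have hL0 : 0 ≤ L := by
    have := (abs_nonneg _).trans (hL 1 (by simp) 0 (by simp))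
    simpa using this
  set a : ℕ → ℝ := fun k => (k : ℝ) / l with ha
  have hsum : ∑ k ∈ range l, ∫ s in a k..a (k + 1), b s = 0 := by
    rw [intervalIntegral.sum_integral_adjacent_intervals fun k _ => hc.intervalIntegrable _ _]
    simpa [ha, hl'.ne'] using hb0
  have hstep (k : ℕ) (hk : k < l) :
      |(∫ s in a k..a (k + 1), b s) - b ((k + 1) / l) * (1 / l)| ≤ L * (1 / l) * (1 / l) := by
    have hlen : a (k + 1) - a k = 1 / l := by simp only [ha]; push_cast; ring
    have hle : a k ≤ a (k + 1) := by
      have : (0 : ℝ) ≤ 1 / l := by positivity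
      linarith
    have h0 : 0 ≤ a k := by positivity
    have h1 : a (k + 1) ≤ 1 := by
      simp only [ha]
      rw [div_le_one hl']
      exact_mod_cast hk
    have heq : (∫ s in a k..a (k + 1), b s) - b ((k + 1) / l) * (1 / l)
        = ∫ s in a k..a (k + 1), (b s - b (a (k + 1))) := by
      rw [intervalIntegral.integral_sub (hc.intervalIntegrable _ _)
        (continuous_const.intervalIntegrable _ _), intervalIntegral.integral_const, hlen]
      simp only [ha, smul_eq_mul]
      push_cast
      ring
    rw [heq, ← Real.norm_eq_abs]
    have := intervalIntegral.norm_integral_le_of_norm_le_const (a := a k) (b := a (k + 1))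
      (f := fun s => b s - b (a (k + 1))) (C := L * (1 / l)) fun s hs => by
        rw [Set.uIoc_of_le hle] at hs
        rw [Real.norm_eq_abs]
        refine (hL s ⟨by linarith [hs.1], by linarith [hs.2]⟩ _ ⟨by linarith, h1⟩).trans ?_
        refine mul_le_mul_of_nonneg_left ?_ hL0
        rw [abs_sub_comm, abs_of_nonneg (by linarith [hs.2])]
        linarith [hs.1]
    rwa [hlen, abs_of_nonneg (by positivity : (0 : ℝ) ≤ 1 / l)] at this
  rw [Fin.sum_univ_eq_sum_range (fun k => b (((k : ℝ) + 1) / l)) l]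
  have htot : |∑ k ∈ range l, ((∫ s in a k..a (k + 1), b s) - b ((k + 1) / l) * (1 / l))|
      ≤ ∑ _k ∈ range l, L * (1 / l) * (1 / l) :=
    (Finset.abs_sum_le_sum_abs _ _).trans
      (Finset.sum_le_sum fun k hk => hstep k (mem_range.mp hk))
  rw [Finset.sum_sub_distrib, hsum, ← Finset.sum_mul, zero_sub, abs_neg, abs_mul,
    Finset.sum_const, card_range, nsmul_eq_mul,
    abs_of_nonneg (by positivity : (0 : ℝ) ≤ 1 / l)] at htot
  have hfin : (l : ℝ) * (L * (1 / l) * (1 / l)) = L * (1 / l) := by field_simp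
  rw [hfin] at htot
  exact le_of_mul_le_mul_right htot (by positivity)

theorem exists_lipschitz_bound (b : ℝ → ℝ) (hb : ContDiff ℝ (⊤ : ℕ∞) b) :
    ∃ L : ℝ, ∀ x ∈ Set.Icc (0 : ℝ) 1, ∀ y ∈ Set.Icc (0 : ℝ) 1, |b x - b y| ≤ L * |x - y| := by
  have hd : Continuous (deriv b) := hb.continuous_deriv (by simp)
  obtain ⟨L, hL⟩ := isCompact_Icc.exists_bound_of_continuousOn (s := Set.Icc (0 : ℝ) 1)
    hd.continuousOn
  refine ⟨L, fun x hx y hy => ?_⟩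
  exact (convex_Icc (0 : ℝ) 1).norm_image_sub_le_of_norm_deriv_le
    (fun z _ => (hb.differentiable (by simp)).differentiableAt) hL hy hx

/-- The extension of a permutation of the first `l` positions to all `l + m` positions. -/
def blockPerm {l : ℕ} (m : ℕ) (g : Equiv.Perm (Fin l)) : Equiv.Perm (Fin (l + m)) :=
  finSumFinEquiv.permCongr (Equiv.Perm.sumCongr g 1)

theorem blockPerm_castAdd {l m : ℕ} (g : Equiv.Perm (Fin l)) (k : Fin l) :
    blockPerm m g (Fin.castAdd m k) = Fin.castAdd m (g k) := by
  simp [blockPerm, Equiv.permCongr_apply]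

theorem blockPerm_natAdd {l m : ℕ} (g : Equiv.Perm (Fin l)) (k : Fin m) :
    blockPerm m g (Fin.natAdd l k) = Fin.natAdd l k := by
  simp [blockPerm, Equiv.permCongr_apply]

theorem blockPerm_swap_mul_apply {l m : ℕ} (g : Equiv.Perm (Fin l)) (i j : Fin l)
    (k : Fin (l + m)) (hi : k ≠ Fin.castAdd m (g⁻¹ i)) (hj : k ≠ Fin.castAdd m (g⁻¹ j)) :
    blockPerm m (Equiv.swap i j * g) k = blockPerm m g k := by
  induction k using Fin.addCases with
  | left k =>
    rw [blockPerm_castAdd, blockPerm_castAdd, Equiv.Perm.mul_apply,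
      Equiv.swap_apply_of_ne_of_ne]
    · rintro rfl; simp at hi
    · rintro rfl; simp at hj
  | right k => rw [blockPerm_natAdd, blockPerm_natAdd]

theorem wt_comp_perm {Ω : Type} [Fintype Ω] (π : Ω → ℝ) {k : ℕ} (σ : Fin k → Ω)
    (e : Equiv.Perm (Fin k)) : wt π (σ ∘ e) = wt π σ :=
  Equiv.prod_comp e fun i => π (σ i)

theorem zAvg_comp_blockPerm {Ω : Type} {d l m : ℕ} (ζ : Ω → Fin d → ℝ) (σ : Fin (l + m) → Ω)
    (g : Equiv.Perm (Fin l)) : zAvg ζ (σ ∘ blockPerm m g) = zAvg ζ σ := by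
  funext i
  have h (k : Fin l) : blockPerm m g ⟨k.1, by omega⟩ = Fin.castAdd m (g k) :=
    blockPerm_castAdd g k
  simp only [zAvg, Function.comp_apply, h]
  congr 1
  exact Equiv.sum_comp g fun k => ζ (σ (Fin.castAdd m k)) i

/-- Conditional expectations given the block average are bounded by uniform bounds on averages
over permutations of the block. -/
theorem condExp_le_of_expect_perm_le {Ω : Type} [Fintype Ω] (π : Ω → ℝ) (hπ0 : ∀ ω, 0 ≤ π ω)
    {d l m : ℕ} (ζ : Ω → Fin d → ℝ) (x : Fin d → ℝ) (f : (Fin (l + m) → Ω) → ℝ) (C : ℝ)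
    (hf : ∀ σ : Fin (l + m) → Ω, 𝔼 g : Equiv.Perm (Fin l), f (σ ∘ blockPerm m g) ≤ C)
    (hx : 0 < ∑ σ : Fin (l + m) → Ω, if zAvg ζ σ = x then wt π σ else 0) :
    condExp π ζ x f ≤ C := by
  have hinv (g : Equiv.Perm (Fin l)) :
      (∑ σ : Fin (l + m) → Ω, if zAvg ζ σ = x then wt π σ * f σ else 0)
        = ∑ σ : Fin (l + m) → Ω,
          if zAvg ζ σ = x then wt π σ * f (σ ∘ blockPerm m g) else 0 := by
    rw [← Equiv.sum_comp ((blockPerm m g).symm.arrowCongr (Equiv.refl Ω))]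
    refine Finset.sum_congr rfl fun σ _ => ?_
    have : ((blockPerm m g).symm.arrowCongr (Equiv.refl Ω)) σ = σ ∘ blockPerm m g := rfl
    rw [this, zAvg_comp_blockPerm, wt_comp_perm]
  rw [condExp, div_le_iff₀ hx]
  calc (∑ σ : Fin (l + m) → Ω, if zAvg ζ σ = x then wt π σ * f σ else 0)
      = 𝔼 g : Equiv.Perm (Fin l), ∑ σ : Fin (l + m) → Ω,
          if zAvg ζ σ = x then wt π σ * f (σ ∘ blockPerm m g) else 0 := by
        rw [← Fintype.expect_const (ι := Equiv.Perm (Fin l))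
          (∑ σ : Fin (l + m) → Ω, if zAvg ζ σ = x then wt π σ * f σ else 0)]
        exact Finset.expect_congr rfl fun g _ => hinv g
    _ = ∑ σ : Fin (l + m) → Ω, if zAvg ζ σ = x then
          wt π σ * 𝔼 g : Equiv.Perm (Fin l), f (σ ∘ blockPerm m g) else 0 := by
        rw [Finset.expect_sum_comm]
        refine Finset.sum_congr rfl fun σ _ => ?_
        split_ifs
        · rw [Finset.mul_expect]
        · simp
    _ ≤ ∑ σ : Fin (l + m) → Ω, C * if zAvg ζ σ = x then wt π σ else 0 := by
        refine Finset.sum_le_sum fun σ _ => ?_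
        split_ifs
        · rw [mul_comm C]
          exact mul_le_mul_of_nonneg_left (hf σ) (Finset.prod_nonneg fun i _ => hπ0 _)
        · simp
    _ = C * ∑ σ : Fin (l + m) → Ω, if zAvg ζ σ = x then wt π σ else 0 := by
        rw [Finset.mul_sum]

theorem sum_window_hits_le (l m p : ℕ) :
    ∑ j : Fin l, ∑ i : Fin m, (if j.1 + i.1 = p then (1 : ℝ) else 0) ≤ m := by
  rw [Finset.sum_comm]
  have h (i : Fin m) : ∑ j : Fin l, (if j.1 + i.1 = p then (1 : ℝ) else 0) ≤ 1 := by
    rw [Finset.sum_boole]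
    have : #{j : Fin l | j.1 + i.1 = p} ≤ 1 := Finset.card_le_one.mpr fun a ha b hb => by
      simp only [mem_filter, mem_univ, true_and] at ha hb
      exact Fin.ext (by omega)
    exact_mod_cast this
  refine (Finset.sum_le_sum fun i _ => h i).trans ?_
  simp

/-- A weighted sum of local observables changes by a bounded amount when the configuration changes
at two sites only. -/
theorem abs_sum_xiAt_sub_le {Ω : Type} {l m : ℕ} (ξ : (Fin m → Ω) → ℝ) (w : Fin l → ℝ)
    (B K : ℝ) (hB : 0 ≤ B) (hw : ∀ j, |w j| ≤ B) (hK : ∀ η, |ξ η| ≤ K) (hK0 : 0 ≤ K)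
    (σ τ : Fin (l + m) → Ω) (p q : Fin (l + m)) (h : ∀ k, k ≠ p → k ≠ q → σ k = τ k) :
    |∑ j, w j * xiAt ξ σ j - ∑ j, w j * xiAt ξ τ j| ≤ 4 * B * K * m := by
  have hterm (j : Fin l) : |w j * xiAt ξ σ j - w j * xiAt ξ τ j|
      ≤ 2 * B * K * (∑ i : Fin m, (if j.1 + i.1 = p.1 then (1 : ℝ) else 0)
        + ∑ i : Fin m, (if j.1 + i.1 = q.1 then (1 : ℝ) else 0)) := by
    have hnn (r : ℕ) : 0 ≤ ∑ i : Fin m, (if j.1 + i.1 = r then (1 : ℝ) else 0) :=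
      Finset.sum_nonneg fun i _ => by positivity
    have hone (r : ℕ) (i : Fin m) (hi : j.1 + i.1 = r) :
        1 ≤ ∑ i : Fin m, (if j.1 + i.1 = r then (1 : ℝ) else 0) := by
      have := Finset.single_le_sum (f := fun i : Fin m => if j.1 + i.1 = r then (1 : ℝ) else 0)
        (fun i _ => by positivity) (Finset.mem_univ i)
      simpa [hi] using this
    rw [← mul_sub, abs_mul]
    by_cases hhit : ∃ i : Fin m, j.1 + i.1 = p.1 ∨ j.1 + i.1 = q.1
    · have h1 : 1 ≤ ∑ i : Fin m, (if j.1 + i.1 = p.1 then (1 : ℝ) else 0)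
          + ∑ i : Fin m, (if j.1 + i.1 = q.1 then (1 : ℝ) else 0) := by
        obtain ⟨i, hi | hi⟩ := hhit
        · linarith [hone _ i hi, hnn q.1]
        · linarith [hone _ i hi, hnn p.1]
      have h2 : |xiAt ξ σ j - xiAt ξ τ j| ≤ 2 * K :=
        (abs_sub _ _).trans ((add_le_add (hK _) (hK _)).trans_eq (two_mul K).symm)
      calc |w j| * |xiAt ξ σ j - xiAt ξ τ j| ≤ B * (2 * K) := by
            gcongr
            exact hw j
        _ = 2 * B * K * 1 := by ring
        _ ≤ _ := by gcongr
    · push Not at hhit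
      have : xiAt ξ σ j = xiAt ξ τ j := by
        unfold xiAt
        congr 1
        funext i
        exact h _ (fun he => (hhit i).1 (congrArg Fin.val he))
          fun he => (hhit i).2 (congrArg Fin.val he)
      rw [this, sub_self, abs_zero, mul_zero]
      have := hnn p.1
      have := hnn q.1
      positivity
  rw [← Finset.sum_sub_distrib]
  refine (Finset.abs_sum_le_sum_abs _ _).trans ((Finset.sum_le_sum fun j _ => hterm j).trans ?_)
  rw [← Finset.mul_sum, Finset.sum_add_distrib]
  calc _ ≤ 2 * B * K * (m + m : ℝ) := by
        gcongr
        · exact sum_window_hits_le l m p.1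
        · exact sum_window_hits_le l m q.1
    _ = _ := by ring

/-- All windows contained in the block have the same average over permutations of the block. -/
theorem expect_xiAt_eq {Ω : Type} {l m : ℕ} [NeZero l] (ξ : (Fin m → Ω) → ℝ)
    (σ : Fin (l + m) → Ω) (j : Fin l) (hj : j.1 + m ≤ l) :
    𝔼 g : Equiv.Perm (Fin l), xiAt ξ (σ ∘ blockPerm m g) j
      = 𝔼 g : Equiv.Perm (Fin l), xiAt ξ (σ ∘ blockPerm m g) 0 := by
  refine Fintype.expect_equiv (Equiv.mulRight (Equiv.addLeft j)) _ _ fun g => ?_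
  simp only [xiAt, Function.comp_apply, Equiv.coe_mulRight]
  congr 1
  funext i
  congr 1
  have hi := i.isLt
  have h0 : (0 : Fin l).1 = 0 := Fin.val_zero l
  have hadd : Equiv.addLeft j (⟨i.1, by omega⟩ : Fin l) = ⟨j.1 + i.1, by omega⟩ := by
    refine Fin.ext ?_
    rw [Equiv.coe_addLeft, Fin.val_add_eq_ite]
    simp only
    split_ifs <;> omega
  have h1 : (⟨j.1 + i.1, by omega⟩ : Fin (l + m))
      = Fin.castAdd m (⟨j.1 + i.1, by omega⟩ : Fin l) := rfl
  have h2 : (⟨(0 : Fin l).1 + i.1, by omega⟩ : Fin (l + m))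
      = Fin.castAdd m (⟨i.1, by omega⟩ : Fin l) := Fin.ext (by simp)
  rw [h1, h2, blockPerm_castAdd, blockPerm_castAdd, Equiv.Perm.mul_apply, hadd]

/-- The average over permutations of a weighted sum of local observables is bounded by the total
weight plus the contribution of the windows leaving the block. -/
theorem abs_expect_sum_xiAt_le {Ω : Type} {l m : ℕ} [NeZero l] (ξ : (Fin m → Ω) → ℝ)
    (w : Fin l → ℝ) (B K L : ℝ) (hB : 0 ≤ B) (hw : ∀ j, |w j| ≤ B) (hK : ∀ η, |ξ η| ≤ K)
    (hK0 : 0 ≤ K) (hL : |∑ j, w j| ≤ L) (σ : Fin (l + m) → Ω) :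
    |𝔼 g : Equiv.Perm (Fin l), ∑ j, w j * xiAt ξ (σ ∘ blockPerm m g) j|
      ≤ K * L + 2 * B * K * m := by
  set e : Fin l → ℝ := fun j => 𝔼 g : Equiv.Perm (Fin l), xiAt ξ (σ ∘ blockPerm m g) j with he
  have heK (j : Fin l) : |e j| ≤ K :=
    (Finset.abs_expect_le _ _).trans (Finset.expect_le univ_nonempty fun g _ => hK _)
  have hmain : 𝔼 g : Equiv.Perm (Fin l), ∑ j, w j * xiAt ξ (σ ∘ blockPerm m g) j
      = e 0 * ∑ j, w j + ∑ j, w j * (e j - e 0) := by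
    rw [Finset.expect_sum_comm, Finset.mul_sum, ← Finset.sum_add_distrib]
    refine Finset.sum_congr rfl fun j _ => ?_
    rw [← Finset.mul_expect]
    ring
  have hterm (j : Fin l) : |w j * (e j - e 0)|
      ≤ 2 * B * K * ∑ i : Fin m, (if j.1 + i.1 = l - 1 then (1 : ℝ) else 0) := by
    have hnn : 0 ≤ ∑ i : Fin m, (if j.1 + i.1 = l - 1 then (1 : ℝ) else 0) :=
      Finset.sum_nonneg fun i _ => by positivity
    by_cases hj : j.1 + m ≤ l
    · have : e j = e 0 := expect_xiAt_eq ξ σ j hj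
      rw [this, sub_self, mul_zero, abs_zero]
      positivity
    · have h1 : 1 ≤ ∑ i : Fin m, (if j.1 + i.1 = l - 1 then (1 : ℝ) else 0) := by
        have := Finset.single_le_sum
          (f := fun i : Fin m => if j.1 + i.1 = l - 1 then (1 : ℝ) else 0)
          (fun i _ => by positivity) (Finset.mem_univ ⟨l - 1 - j.1, by omega⟩)
        have hval : j.1 + (l - 1 - j.1) = l - 1 := by omega
        simpa [hval] using this
      rw [abs_mul]
      calc |w j| * |e j - e 0| ≤ B * (2 * K) := by
            gcongr
            · exact hw j
            · exact (abs_sub _ _).trans (by linarith [heK j, heK 0])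
        _ = 2 * B * K * 1 := by ring
        _ ≤ _ := by gcongr
  rw [hmain]
  refine (abs_add_le _ _).trans (add_le_add ?_ ?_)
  · rw [abs_mul]
    gcongr
    exact heK 0
  · refine (Finset.abs_sum_le_sum_abs _ _).trans
      ((Finset.sum_le_sum fun j _ => hterm j).trans ?_)
    rw [← Finset.mul_sum]
    gcongr
    exact sum_window_hits_le l m (l - 1)

/-- Microcanonical Gaussian bound, part (i): if ∫₀¹ b = 0 then there is
γ₀ > 0, depending only on m, the joint law and b, such that
log E[exp{γ₀ l ⟨b,ξ⟩_l²} | ζ̄_l = x] ≤ 1 uniformly in l and x. -/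
theorem stmt_18 {Ω : Type} [Fintype Ω] [Nonempty Ω]
    (π : Ω → ℝ) (hπ0 : ∀ ω, 0 ≤ π ω) (hπ1 : ∑ ω, π ω = 1)
    (d m : ℕ) (ζ : Ω → Fin d → ℝ) (ξ : (Fin m → Ω) → ℝ)
    (b : ℝ → ℝ) (hb : ContDiff ℝ (⊤ : ℕ∞) b)
    (hb0 : (∫ s in (0:ℝ)..1, b s) = 0) :
    ∃ γ₀ : ℝ, 0 < γ₀ ∧ ∀ l : ℕ, 0 < l → ∀ x : Fin d → ℝ,
      (0 < ∑ σ : Fin (l + m) → Ω, if zAvg ζ σ = x then wt π σ else 0) →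
      Real.log (condExp π ζ x
          (fun σ : Fin (l + m) → Ω =>
            Real.exp (γ₀ * l * (bAvg b ξ σ)^2))) ≤ 1 := by
  obtain ⟨L, hL⟩ := exists_lipschitz_bound b hb
  obtain ⟨B, hB⟩ := isCompact_Icc.exists_bound_of_continuousOn (s := Set.Icc (0 : ℝ) 1)
    hb.continuous.continuousOn
  have hB0 : 0 ≤ B := (norm_nonneg _).trans (hB 0 (by simp))
  obtain ⟨K, hK0, hK⟩ : ∃ K : ℝ, 0 ≤ K ∧ ∀ η, |ξ η| ≤ K :=
    ⟨∑ η, |ξ η|, Finset.sum_nonneg fun η _ => abs_nonneg _, fun η =>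
      Finset.single_le_sum (f := fun η => |ξ η|) (fun η _ => abs_nonneg _) (Finset.mem_univ η)⟩
  set c : ℝ := 4 * B * K * m with hc
  set M : ℝ := K * L + 2 * B * K * m with hM
  set D : ℝ := 64 * (2 * c) ^ 2 + 4 * M ^ 2 + 1 with hD
  have hDpos : 0 < D := by positivity
  refine ⟨1 / D, by positivity, fun l hl x hx => ?_⟩
  have hl' : (0 : ℝ) < l := by exact_mod_cast hl
  have : NeZero l := ⟨hl.ne'⟩
  set w : Fin l → ℝ := fun j => b (((j.1 : ℝ) + 1) / l) with hw
  have hwB (j : Fin l) : |w j| ≤ B := by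
    refine hB _ ⟨by positivity, ?_⟩
    rw [div_le_one hl']
    exact_mod_cast j.isLt
  have hwL : |∑ j, w j| ≤ L :=
    abs_sum_div_le_of_integral_eq_zero b hb.continuous L hL hb0 l hl
  have hnonneg : 0 ≤ condExp π ζ x (fun σ : Fin (l + m) → Ω =>
      Real.exp (1 / D * l * (bAvg b ξ σ) ^ 2)) := by
    refine div_nonneg (Finset.sum_nonneg fun σ _ => ?_) hx.le
    have hwt : 0 ≤ wt π σ := Finset.prod_nonneg fun i _ => hπ0 _
    split_ifs <;> positivity
  rcases hnonneg.eq_or_lt with h0 | hpos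
  · rw [← h0]; simp
  refine (Real.log_le_iff_le_exp hpos).mpr ?_
  refine condExp_le_of_expect_perm_le π hπ0 ζ x _ _ (fun σ => ?_) hx
  set F : Equiv.Perm (Fin l) → ℝ := fun g => ∑ j, w j * xiAt ξ (σ ∘ blockPerm m g) j with hF
  set E : ℝ := 𝔼 g, F g with hE
  have hEM : |E| ≤ M := abs_expect_sum_xiAt_le ξ w B K L hB0 hwB hK hK0 hwL σ
  have hswap (i j : Fin l) (g : Equiv.Perm (Fin l)) :
      |F (Equiv.swap i j * g) - F g| ≤ c :=
    abs_sum_xiAt_sub_le ξ w B K hB0 hwB hK hK0 _ _ (Fin.castAdd m (g⁻¹ i))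
      (Fin.castAdd m (g⁻¹ j)) fun k hi hj =>
        congrArg σ (blockPerm_swap_mul_apply g i j k hi hj)
  have hsq : 𝔼 g, Real.exp (2 / (D * l) * (F g - E) ^ 2) ≤ √2 := by
    refine expect_exp_sq_le (fun g => F g - E) (l * (2 * c) ^ 2) _ (by positivity) (fun t => ?_) ?_
    · rw [mul_assoc]
      exact expect_perm_exp_le c t l F hswap
    · have : 8 * (l * (2 * c) ^ 2) * (2 / (D * l)) = 16 * (2 * c) ^ 2 / D := by
        field_simp
        ring
      rw [this, div_le_one hDpos]
      nlinarith [sq_nonneg (2 * c), sq_nonneg M]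
  have hexp (g : Equiv.Perm (Fin l)) :
      Real.exp (1 / D * l * bAvg b ξ (σ ∘ blockPerm m g) ^ 2)
        ≤ Real.exp (1 / 2) * Real.exp (2 / (D * l) * (F g - E) ^ 2) := by
    rw [← Real.exp_add, Real.exp_le_exp]
    have h1 : bAvg b ξ (σ ∘ blockPerm m g) = (l : ℝ)⁻¹ * F g := rfl
    have h2 : 1 / D * l * ((l : ℝ)⁻¹ * F g) ^ 2 = F g ^ 2 / (D * l) := by
      field_simp
    have h3 : F g ^ 2 ≤ 2 * (F g - E) ^ 2 + 2 * E ^ 2 := by nlinarith [sq_nonneg (F g - 2 * E)]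
    have h4 : E ^ 2 ≤ M ^ 2 := sq_le_sq' (abs_le.mp hEM).1 (abs_le.mp hEM).2
    have h5 : 2 * E ^ 2 / (D * l) ≤ 1 / 2 := by
      have hl1 : (1 : ℝ) ≤ l := by exact_mod_cast hl
      rw [div_le_iff₀ (by positivity)]
      nlinarith [sq_nonneg (2 * c), mul_le_mul_of_nonneg_left hl1 hDpos.le]
    rw [h1, h2]
    calc F g ^ 2 / (D * l) ≤ (2 * (F g - E) ^ 2 + 2 * E ^ 2) / (D * l) := by gcongr
      _ = 2 * E ^ 2 / (D * l) + 2 / (D * l) * (F g - E) ^ 2 := by ring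
      _ ≤ _ := by gcongr
  have hsqrt : √2 ≤ Real.exp (1 / 2) := by
    rw [Real.sqrt_le_left (Real.exp_pos _).le, ← Real.exp_nat_mul]
    norm_num
    linarith [Real.add_one_le_exp (1 : ℝ)]
  calc 𝔼 g : Equiv.Perm (Fin l), Real.exp (1 / D * l * bAvg b ξ (σ ∘ blockPerm m g) ^ 2)
      ≤ 𝔼 g, Real.exp (1 / 2) * Real.exp (2 / (D * l) * (F g - E) ^ 2) :=
        Finset.expect_le_expect fun g _ => hexp g
    _ = Real.exp (1 / 2) * 𝔼 g, Real.exp (2 / (D * l) * (F g - E) ^ 2) :=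
        (Finset.mul_expect _ _ _).symm
    _ ≤ Real.exp (1 / 2) * Real.exp (1 / 2) := by
        gcongr
        exact hsq.trans hsqrt
    _ = Real.exp 1 := by rw [← Real.exp_add]; norm_num
end
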